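/- arXiv:2411.13823 — 3 statements merged into one kernel-verified Lean document; each statement's English description precedes it below -/
import Mathlib

section
/- Suppose ≿ satisfies Axiom 1 (completeness and transitivity), Axiom 2 (Monotonicity), and Axiom 3 (Replacement Monotonicity). If x ∈ X, α ∈ [0,1], η ∈ [0,1], and αδ_x + (1-α)δ_b ∼ (1-η)δ_b + ηδ_w, then η ≤ α. -/
open Set

noncomputable section

/-- The Dirac lottery `δ_x` at a prize `x`. -/
def delta (x : ℝ) : ℝ → ℝ := fun y => if y = x then 1 else 0

/-- `p` is a simple lottery on the prize space `X = [w, b]`: a finitely supported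
function into `[0,1]` vanishing outside `[w,b]` and summing to `1`. -/
def IsLottery (w b : ℝ) (p : ℝ → ℝ) : Prop :=
  (Function.support p).Finite ∧ (∀ x, 0 ≤ p x ∧ p x ≤ 1) ∧
    (∀ x, x ∉ Icc w b → p x = 0) ∧ (∑ᶠ x, p x) = 1

/-- The probability `p(S)` that a lottery assigns to a set of prizes. -/
def prob (p : ℝ → ℝ) (S : Set ℝ) : ℝ := ∑ᶠ x ∈ S, p x

/-- Indifference: the symmetric part `∼` of `≿`. -/
def Indiff (R : (ℝ → ℝ) → (ℝ → ℝ) → Prop) (p q : ℝ → ℝ) : Prop := R p q ∧ R q p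

/-- Strict preference: the asymmetric part `≻` of `≿`. -/
def StrictPref (R : (ℝ → ℝ) → (ℝ → ℝ) → Prop) (p q : ℝ → ℝ) : Prop := R p q ∧ ¬ R q p

/-- Axiom 1 (first half): `≿` is complete on simple lotteries. -/
def CompleteAx (w b : ℝ) (R : (ℝ → ℝ) → (ℝ → ℝ) → Prop) : Prop :=
  ∀ p q, IsLottery w b p → IsLottery w b q → R p q ∨ R q p

/-- Axiom 1 (second half): `≿` is transitive on simple lotteries. -/
def TransitiveAx (w b : ℝ) (R : (ℝ → ℝ) → (ℝ → ℝ) → Prop) : Prop :=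
  ∀ p q r, IsLottery w b p → IsLottery w b q → IsLottery w b r → R p q → R q r → R p r

/-- Axiom 2 (Monotonicity). -/
def MonotonicityAx (w b : ℝ) (R : (ℝ → ℝ) → (ℝ → ℝ) → Prop) : Prop :=
  ∀ t₁ ∈ Icc (0:ℝ) 1, ∀ t₂ ∈ Icc (0:ℝ) 1,
    (R (t₁ • delta b + (1 - t₁) • delta w) (t₂ • delta b + (1 - t₂) • delta w) ↔ t₂ ≤ t₁)

/-- Axiom 3 (Replacement Monotonicity). -/
def ReplacementMonotonicityAx (w b : ℝ) (R : (ℝ → ℝ) → (ℝ → ℝ) → Prop) : Prop :=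
  ∀ x ∈ Icc w b, ∀ α ∈ Icc (0:ℝ) 1,
    R (α • delta b + (1 - α) • delta x) (α • delta b + (1 - α) • delta w) ∧
    R (α • delta b + (1 - α) • delta w) (α • delta x + (1 - α) • delta w)

/-- Axiom 4 (Weak Solvability). -/
def WeakSolvabilityAx (w b : ℝ) (R : (ℝ → ℝ) → (ℝ → ℝ) → Prop) : Prop :=
  ∀ p, IsLottery w b p → ∃ γ ∈ Icc (0:ℝ) 1, Indiff R p (γ • delta b + (1 - γ) • delta w)

/-- A family `u π` of utility functions, indexed by the disappointment probability
`π ∈ [0,1]`, is contextual for the threshold `d`. -/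
def Contextual (w b d : ℝ) (u : ℝ → ℝ → ℝ) : Prop :=
  (∀ π ∈ Icc (0:ℝ) 1, ∀ μ ∈ Icc (0:ℝ) 1, u π w = u μ w ∧ u π b = u μ b) ∧
  (∀ π ∈ Icc (0:ℝ) 1, u π w < u π b) ∧
  (∀ π ∈ Icc (0:ℝ) 1, ∀ x ∈ Ioo w b, u π x ∈ Icc (u π w) (u π b)) ∧
  (d ≠ b → ∀ x ∈ Ioo w b, ∃ π ∈ Ioo (0:ℝ) 1, ∃ μ ∈ Ioo (0:ℝ) 1, u π x ≠ u μ x)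

/-- The ECU value of a lottery `p`: `V(p) = ∑ₓ p(x) · u_π(x)` where `π = p([w,d])`. -/
def ECUval (w b d : ℝ) (u : ℝ → ℝ → ℝ) (p : ℝ → ℝ) : ℝ :=
  ∑ᶠ x, p x * u (prob p (Icc w d)) x

/-- `(d, u)` is an expected contextual utility (ECU) representation of `≿`. -/
def IsECU (w b : ℝ) (R : (ℝ → ℝ) → (ℝ → ℝ) → Prop) (d : ℝ) (u : ℝ → ℝ → ℝ) : Prop :=
  d ∈ Icc w b ∧ Contextual w b d u ∧
    ∀ p q, IsLottery w b p → IsLottery w b q →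
      (R p q ↔ ECUval w b d u q ≤ ECUval w b d u p)

/-- `φ` assigns to each prize `x` the value `φ_x ∈ [0,1]` with `δ_x ∼ φ_x δ_b + (1-φ_x) δ_w`. -/
def IsPhi (w b : ℝ) (R : (ℝ → ℝ) → (ℝ → ℝ) → Prop) (φ : ℝ → ℝ) : Prop :=
  ∀ x ∈ Icc w b, φ x ∈ Icc (0:ℝ) 1 ∧
    Indiff R (delta x) (φ x • delta b + (1 - φ x) • delta w)

/-- The set `𝒟` defined from the preference relation via the values `φ_x`. -/
def Dset (w b : ℝ) (R : (ℝ → ℝ) → (ℝ → ℝ) → Prop) (φ : ℝ → ℝ) : Set ℝ :=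
  { x | x ∈ Ico w b ∧ ∀ α ∈ Icc (0:ℝ) 1,
      Indiff R (α • delta x + (1 - α) • delta w)
        ((α * φ x) • delta b + (α * (1 - φ x)) • delta w + (1 - α) • delta w) }

/-- A mixture of two Dirac lotteries at prizes in `[w, b]` is a simple lottery. -/
theorem isLottery_mix {w b y z t : ℝ} (hy : y ∈ Icc w b) (hz : z ∈ Icc w b)
    (ht : t ∈ Icc (0:ℝ) 1) : IsLottery w b (t • delta y + (1 - t) • delta z) := by
  obtain ⟨ht0, ht1⟩ := ht
  have hsupp : Function.support (t • delta y + (1 - t) • delta z) ⊆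
      (({y, z} : Finset ℝ) : Set ℝ) := by
    intro v hv
    by_contra h
    simp only [Finset.coe_insert, Finset.coe_singleton, mem_insert_iff, mem_singleton_iff,
      not_or] at h
    exact hv (by simp [delta, h.1, h.2])
  refine ⟨(Finset.finite_toSet _).subset hsupp, fun v => ?_, fun v hv => ?_, ?_⟩
  · simp only [delta, Pi.add_apply, Pi.smul_apply, smul_eq_mul]
    split_ifs <;> constructor <;> linarith
  · have hvy : v ≠ y := fun h => hv (h ▸ hy)
    have hvz : v ≠ z := fun h => hv (h ▸ hz)
    simp [delta, hvy, hvz]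
  · rw [finsum_eq_sum_of_support_subset _ hsupp]
    simp [delta, Finset.sum_add_distrib]

/-- Under Axioms 1–3, if `αδ_x + (1-α)δ_b ∼ (1-η)δ_b + ηδ_w` then `η ≤ α`. -/
theorem stmt_2 (w b : ℝ) (hwb : w < b) (R : (ℝ → ℝ) → (ℝ → ℝ) → Prop)
    (h1c : CompleteAx w b R) (h1t : TransitiveAx w b R)
    (h2 : MonotonicityAx w b R) (h3 : ReplacementMonotonicityAx w b R)
    (x : ℝ) (hx : x ∈ Icc w b) (α : ℝ) (hα : α ∈ Icc (0:ℝ) 1)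
    (η : ℝ) (hη : η ∈ Icc (0:ℝ) 1)
    (hind : Indiff R (α • delta x + (1 - α) • delta b)
      ((1 - η) • delta b + η • delta w)) :
    η ≤ α := by
  have hw : w ∈ Icc w b := left_mem_Icc.2 hwb.le
  have hb : b ∈ Icc w b := right_mem_Icc.2 hwb.le
  have hα' : 1 - α ∈ Icc (0:ℝ) 1 := ⟨by linarith [hα.2], by linarith [hα.1]⟩
  have hη' : 1 - η ∈ Icc (0:ℝ) 1 := ⟨by linarith [hη.2], by linarith [hη.1]⟩
  have hworse := (h3 x hx (1 - α) hα').1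
  have hbetter : R ((1 - η) • delta b + (1 - (1 - η)) • delta w)
      ((1 - α) • delta b + (1 - (1 - α)) • delta x) := by
    rw [sub_sub_cancel, sub_sub_cancel, add_comm ((1 - α) • delta b)]
    exact hind.2
  have := (h2 _ hη' _ hα').1 (h1t _ _ _ (isLottery_mix hb hw hη') (isLottery_mix hb hx hα')
    (isLottery_mix hb hw hα') hbetter hworse)
  linarith
end
end

section
/- If ≿ has an ECU representation with threshold d and d ≠ b, then every x ∈ (d,b) satisfies x ∉ 𝒟; consequently 𝒟 = [w,d]. -/
open Set

noncomputable section

theorem finsum_mixture_mul (a c x y : ℝ) (g : ℝ → ℝ) :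
    ∑ᶠ z, (a • delta x + c • delta y) z * g z = a * g x + c * g y := by
  have hsub : Function.support (fun z => (a • delta x + c • delta y) z * g z) ⊆
      (({x, y} : Finset ℝ) : Set ℝ) := by
    intro z hz
    by_contra hn
    simp only [Finset.coe_insert, Finset.coe_singleton, mem_insert_iff, mem_singleton_iff,
      not_or] at hn
    exact hz (by simp [delta, hn.1, hn.2])
  rw [finsum_eq_sum_of_support_subset _ hsub]
  by_cases hxy : x = y
  · subst hxy
    simp [delta]
    ring
  · rw [Finset.sum_pair hxy]
    simp [delta, hxy, Ne.symm hxy]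

theorem prob_mixture (a c x y : ℝ) (S : Set ℝ) :
    prob (a • delta x + c • delta y) S =
      a * S.indicator (fun _ => 1) x + c * S.indicator (fun _ => 1) y := by
  rw [← finsum_mixture_mul, prob, finsum_mem_def]
  refine finsum_congr fun z => ?_
  by_cases hz : z ∈ S <;> simp [hz]

theorem isLottery_mixture {w b x y a : ℝ} (hx : x ∈ Icc w b) (hy : y ∈ Icc w b)
    (ha : a ∈ Icc (0:ℝ) 1) : IsLottery w b (a • delta x + (1 - a) • delta y) := by
  obtain ⟨ha0, ha1⟩ := ha
  refine ⟨(Set.toFinite {x, y}).subset fun z hz => ?_, fun z => ?_, fun z hz => ?_, ?_⟩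
  · by_contra hn
    simp only [mem_insert_iff, mem_singleton_iff, not_or] at hn
    exact hz (by simp [delta, hn.1, hn.2])
  · simp only [delta, Pi.add_apply, Pi.smul_apply, smul_eq_mul]
    split_ifs <;> constructor <;> linarith
  · have h1 : z ≠ x := fun h => hz (h ▸ hx)
    have h2 : z ≠ y := fun h => hz (h ▸ hy)
    simp [delta, h1, h2]
  · simpa using finsum_mixture_mul a (1 - a) x y fun _ => 1

theorem ECUval_mixture (w b d : ℝ) (u : ℝ → ℝ → ℝ) (a c x y : ℝ) :
    ECUval w b d u (a • delta x + c • delta y) =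
      a * u (a * (Icc w d).indicator (fun _ => 1) x + c * (Icc w d).indicator (fun _ => 1) y) x +
      c * u (a * (Icc w d).indicator (fun _ => 1) x + c * (Icc w d).indicator (fun _ => 1) y) y := by
  rw [ECUval, prob_mixture, finsum_mixture_mul]

theorem IsECU.indiff_iff {w b d : ℝ} {R : (ℝ → ℝ) → (ℝ → ℝ) → Prop} {u : ℝ → ℝ → ℝ}
    (h : IsECU w b R d u) {p q : ℝ → ℝ} (hp : IsLottery w b p) (hq : IsLottery w b q) :
    Indiff R p q ↔ ECUval w b d u p = ECUval w b d u q := by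
  rw [Indiff, h.2.2 p q hp hq, h.2.2 q p hq hp, and_comm]
  exact le_antisymm_iff.symm

/-- The value of a lottery over the best and the worst prize is its expected utility. -/
theorem IsECU.ECUval_best_worst {w b d : ℝ} {R : (ℝ → ℝ) → (ℝ → ℝ) → Prop} {u : ℝ → ℝ → ℝ}
    (h : IsECU w b R d u) (hd : d ≠ b) {t : ℝ} (ht : t ∈ Icc (0:ℝ) 1) :
    ECUval w b d u (t • delta b + (1 - t) • delta w) = t * u 1 b + (1 - t) * u 1 w := by
  have hdb : d < b := lt_of_le_of_ne h.1.2 hd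
  have hb : b ∉ Icc w d := fun hb => absurd hb.2 (not_le.2 hdb)
  have hw : w ∈ Icc w d := ⟨le_rfl, h.1.1⟩
  have hu := h.2.1.1 (1 - t) ⟨by linarith [ht.2], by linarith [ht.1]⟩ 1 ⟨by simp, le_rfl⟩
  rw [ECUval_mixture]
  simp [hb, hw, hu.1, hu.2]

/-- Membership in `𝒟`, expressed through the utility functions. -/
theorem IsECU.mem_Dset_iff {w b d : ℝ} {R : (ℝ → ℝ) → (ℝ → ℝ) → Prop} {u : ℝ → ℝ → ℝ}
    (h : IsECU w b R d u) (hd : d ≠ b) {φ : ℝ → ℝ} (hφ : IsPhi w b R φ) {x : ℝ}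
    (hx : x ∈ Ico w b) :
    x ∈ Dset w b R φ ↔ ∀ α ∈ Icc (0:ℝ) 1,
      ECUval w b d u (α • delta x + (1 - α) • delta w) =
        α * φ x * u 1 b + (1 - α * φ x) * u 1 w := by
  have hxX : x ∈ Icc w b := ⟨hx.1, hx.2.le⟩
  have hwX : w ∈ Icc w b := ⟨le_rfl, hx.1.trans hx.2.le⟩
  have hbX : b ∈ Icc w b := ⟨hx.1.trans hx.2.le, le_rfl⟩
  have key : ∀ α ∈ Icc (0:ℝ) 1,
      (Indiff R (α • delta x + (1 - α) • delta w)
        ((α * φ x) • delta b + (α * (1 - φ x)) • delta w + (1 - α) • delta w) ↔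
      ECUval w b d u (α • delta x + (1 - α) • delta w) =
        α * φ x * u 1 b + (1 - α * φ x) * u 1 w) := by
    intro α hα
    have ht : α * φ x ∈ Icc (0:ℝ) 1 :=
      unitInterval.mul_mem hα (hφ x hxX).1
    have e : (α * φ x) • delta b + (α * (1 - φ x)) • delta w + (1 - α) • delta w =
        (α * φ x) • delta b + (1 - α * φ x) • delta w := by module
    rw [e, h.indiff_iff (isLottery_mixture hxX hwX hα) (isLottery_mixture hbX hwX ht),
      h.ECUval_best_worst hd ht]
  exact ⟨fun H α hα => (key α hα).1 (H.2 α hα), fun H => ⟨hx, fun α hα => (key α hα).2 (H α hα)⟩⟩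

theorem IsECU.notMem_Dset {w b d : ℝ} {R : (ℝ → ℝ) → (ℝ → ℝ) → Prop} {u : ℝ → ℝ → ℝ}
    (h : IsECU w b R d u) (hd : d ≠ b) {φ : ℝ → ℝ} (hφ : IsPhi w b R φ) {x : ℝ}
    (hx : x ∈ Ioo d b) : x ∉ Dset w b R φ := by
  intro hxD
  have hwx : w < x := h.1.1.trans_lt hx.1
  have hxS : x ∉ Icc w d := fun hS => absurd hS.2 (not_le.2 hx.1)
  have hwS : w ∈ Icc w d := ⟨le_rfl, h.1.1⟩
  have hval : ∀ π ∈ Ioo (0:ℝ) 1, u π x = φ x * u 1 b + (1 - φ x) * u 1 w := by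
    intro π hπ
    have H := (h.mem_Dset_iff hd hφ ⟨hwx.le, hx.2⟩).1 hxD (1 - π)
      ⟨by linarith [hπ.2], by linarith [hπ.1]⟩
    have hu := (h.2.1.1 π ⟨hπ.1.le, hπ.2.le⟩ 1 ⟨by simp, le_rfl⟩).1
    rw [ECUval_mixture] at H
    simp only [hxS, hwS, indicator_of_notMem, indicator_of_mem, not_false_eq_true, mul_zero,
      mul_one, zero_add, sub_sub_cancel, hu] at H
    refine mul_left_cancel₀ (sub_pos.2 hπ.2).ne' ?_
    linear_combination H
  obtain ⟨π, hπ, μ, hμ, hne⟩ := h.2.1.2.2.2 hd x ⟨hwx, hx.2⟩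
  exact hne ((hval π hπ).trans (hval μ hμ).symm)

theorem IsECU.mem_Dset {w b d : ℝ} {R : (ℝ → ℝ) → (ℝ → ℝ) → Prop} {u : ℝ → ℝ → ℝ}
    (h : IsECU w b R d u) (hd : d ≠ b) {φ : ℝ → ℝ} (hφ : IsPhi w b R φ) {x : ℝ}
    (hx : x ∈ Icc w d) : x ∈ Dset w b R φ := by
  have hdb : d < b := lt_of_le_of_ne h.1.2 hd
  have hxb : x < b := hx.2.trans_lt hdb
  have hwb : w ≤ b := hx.1.trans hxb.le
  have hwS : w ∈ Icc w d := ⟨le_rfl, h.1.1⟩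
  have hval : ∀ α : ℝ, ECUval w b d u (α • delta x + (1 - α) • delta w) =
      α * u 1 x + (1 - α) * u 1 w := by
    intro α
    rw [ECUval_mixture]
    simp [hx, hwS]
  obtain ⟨hφx, hind⟩ := hφ x ⟨hx.1, hxb.le⟩
  have e : delta x = (1:ℝ) • delta x + (1 - 1 : ℝ) • delta w := by simp
  rw [e, h.indiff_iff (isLottery_mixture ⟨hx.1, hxb.le⟩ ⟨le_rfl, hwb⟩ ⟨by simp, le_rfl⟩)
    (isLottery_mixture ⟨hwb, le_rfl⟩ ⟨le_rfl, hwb⟩ hφx), hval, h.ECUval_best_worst hd hφx] at hind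
  rw [h.mem_Dset_iff hd hφ ⟨hx.1, hxb⟩]
  intro α _
  rw [hval]
  linear_combination α * hind

/-- If `≿` has an ECU representation with threshold `d ≠ b`, then every `x ∈ (d,b)`
is outside `𝒟`; consequently `𝒟 = [w,d]`. -/
theorem stmt_5 (w b : ℝ) (hwb : w < b) (R : (ℝ → ℝ) → (ℝ → ℝ) → Prop)
    (d : ℝ) (u : ℝ → ℝ → ℝ) (hECU : IsECU w b R d u) (hd : d ≠ b)
    (φ : ℝ → ℝ) (hφ : IsPhi w b R φ) :
    (∀ x ∈ Ioo d b, x ∉ Dset w b R φ) ∧ Dset w b R φ = Icc w d := by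
  refine ⟨fun x hx => hECU.notMem_Dset hd hφ hx, Set.ext fun x => ⟨fun hx => ?_, hECU.mem_Dset hd hφ⟩⟩
  refine ⟨hx.1.1, not_lt.1 fun hdx => ?_⟩
  exact hECU.notMem_Dset hd hφ ⟨hdx, hx.1.2⟩ hx
end
end

section
/- If ≿ has an ECU representation, then ≿ satisfies Weak Solvability: for every simple lottery p there exists γ ∈ [0,1] with p ∼ γδ_b + (1-γ)δ_w. -/
open Set

noncomputable section

/-- The expectation of `f` under a lottery lies between any bounds for `f` on the prize space. -/
theorem IsLottery.finsum_mul_mem_Icc {w b : ℝ} {p : ℝ → ℝ} (hp : IsLottery w b p)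
    {f : ℝ → ℝ} {m M : ℝ} (hf : ∀ x ∈ Icc w b, f x ∈ Icc m M) :
    ∑ᶠ x, p x * f x ∈ Icc m M := by
  obtain ⟨hfin, h01, hout, hsum⟩ := hp
  have hsub : Function.support p ⊆ hfin.toFinset := by simp
  rw [finsum_eq_sum_of_support_subset p hsub] at hsum
  rw [finsum_eq_sum_of_support_subset (fun x => p x * f x)
    ((Function.support_mul_subset_left p f).trans hsub)]
  have hbound : ∀ x, p x * m ≤ p x * f x ∧ p x * f x ≤ p x * M := by
    intro x
    by_cases hx : x ∈ Icc w b
    · exact ⟨mul_le_mul_of_nonneg_left (hf x hx).1 (h01 x).1,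
        mul_le_mul_of_nonneg_left (hf x hx).2 (h01 x).1⟩
    · simp [hout x hx]
  constructor
  · calc m = ∑ x ∈ hfin.toFinset, p x * m := by rw [← Finset.sum_mul, hsum, one_mul]
      _ ≤ _ := Finset.sum_le_sum fun x _ => (hbound x).1
  · calc _ ≤ ∑ x ∈ hfin.toFinset, p x * M := Finset.sum_le_sum fun x _ => (hbound x).2
      _ = M := by rw [← Finset.sum_mul, hsum, one_mul]

theorem IsLottery.prob_mem_Icc {w b : ℝ} {p : ℝ → ℝ} (hp : IsLottery w b p) (S : Set ℝ) :
    prob p S ∈ Icc (0 : ℝ) 1 := by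
  have h : prob p S = ∑ᶠ x, p x * S.indicator 1 x := by
    rw [prob, finsum_mem_def]
    refine finsum_congr fun x => ?_
    by_cases hx : x ∈ S <;> simp [hx]
  rw [h]
  refine hp.finsum_mul_mem_Icc fun x _ => ?_
  by_cases hx : x ∈ S <;> simp [hx]

theorem support_mix_delta_subset (x y γ : ℝ) :
    Function.support (γ • delta x + (1 - γ) • delta y) ⊆ ({x, y} : Finset ℝ) := by
  intro z hz
  by_contra hne
  simp only [Finset.coe_insert, Finset.coe_singleton, mem_insert_iff, mem_singleton_iff,
    not_or] at hne
  simp [delta, hne.1, hne.2] at hz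

theorem finsum_mix_delta_mul {x y : ℝ} (hxy : x ≠ y) (γ : ℝ) (f : ℝ → ℝ) :
    ∑ᶠ z, (γ • delta x + (1 - γ) • delta y) z * f z = γ * f x + (1 - γ) * f y := by
  rw [finsum_eq_sum_of_support_subset _ ((Function.support_mul_subset_left _ f).trans
    (support_mix_delta_subset x y γ)), Finset.sum_pair hxy]
  simp [delta, hxy, hxy.symm]

theorem isLottery_mix_delta {w b x y γ : ℝ} (hx : x ∈ Icc w b) (hy : y ∈ Icc w b)
    (hxy : x ≠ y) (hγ : γ ∈ Icc (0 : ℝ) 1) :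
    IsLottery w b (γ • delta x + (1 - γ) • delta y) := by
  refine ⟨(Finset.finite_toSet _).subset (support_mix_delta_subset x y γ), fun z => ?_,
    fun z hz => ?_, ?_⟩
  · obtain ⟨h0, h1⟩ := hγ
    by_cases hzx : z = x
    · subst hzx
      simp [delta, hxy, h0, h1]
    · by_cases hzy : z = y <;> simp [delta, hzx, hzy, hxy.symm, h0, h1]
  · have hzx : z ≠ x := fun h => hz (h ▸ hx)
    have hzy : z ≠ y := fun h => hz (h ▸ hy)
    simp [delta, hzx, hzy]
  · simpa using finsum_mix_delta_mul hxy γ 1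

/-- If `≿` has an ECU representation, then `≿` satisfies Weak Solvability (Axiom 4). -/
theorem stmt_13 (w b : ℝ) (hwb : w < b) (R : (ℝ → ℝ) → (ℝ → ℝ) → Prop)
    (d : ℝ) (u : ℝ → ℝ → ℝ) (hECU : IsECU w b R d u) :
    WeakSolvabilityAx w b R := by
  obtain ⟨-, ⟨hconst, hlt, hmem, -⟩, hR⟩ := hECU
  intro p hp
  have hπ := hp.prob_mem_Icc (Icc w d)
  set π := prob p (Icc w d)
  have hpos : 0 < u π b - u π w := sub_pos.2 (hlt π hπ)
  have hV : ECUval w b d u p ∈ Icc (u π w) (u π b) := by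
    refine hp.finsum_mul_mem_Icc fun x hx => ?_
    rcases eq_or_lt_of_le hx.1 with rfl | hwx
    · exact ⟨le_rfl, (hlt π hπ).le⟩
    rcases eq_or_lt_of_le hx.2 with rfl | hxb
    · exact ⟨(hlt π hπ).le, le_rfl⟩
    exact hmem π hπ x ⟨hwx, hxb⟩
  set γ := (ECUval w b d u p - u π w) / (u π b - u π w)
  have hγ : γ ∈ Icc (0 : ℝ) 1 :=
    ⟨div_nonneg (sub_nonneg.2 hV.1) hpos.le,
      (div_le_one hpos).2 (sub_le_sub_right hV.2 _)⟩
  have hq := isLottery_mix_delta (right_mem_Icc.2 hwb.le) (left_mem_Icc.2 hwb.le) hwb.ne' hγ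
  have hval : ECUval w b d u (γ • delta b + (1 - γ) • delta w) = ECUval w b d u p := by
    have hu := hconst _ (hq.prob_mem_Icc (Icc w d)) π hπ
    have hγ_mul : γ * (u π b - u π w) = ECUval w b d u p - u π w := div_mul_cancel₀ _ hpos.ne'
    rw [ECUval, finsum_mix_delta_mul hwb.ne', hu.1, hu.2]
    linarith
  exact ⟨γ, hγ, (hR _ _ hp hq).2 hval.le, (hR _ _ hq hp).2 hval.ge⟩
end
end
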